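/- Let X be a finite set and let Z be a family of subsets of X. Then the maximum size of a Z-agreeing family of subsets of X equals the maximum size of a Z-intersecting family of subsets of X. -/

import Mathlib

/-- `F` is `Z`-intersecting: any two members contain a common member of `Z`. -/
def ZIntersecting {X : Type*} [DecidableEq X]
    (Z : Finset (Finset X)) (F : Finset (Finset X)) : Prop :=
  ∀ A ∈ F, ∀ B ∈ F, ∃ Z₀ ∈ Z, Z₀ ⊆ A ∩ B

/-- `F` is `Z`-agreeing: any two members agree on some member of `Z`,
i.e. some member of `Z` is disjoint from their symmetric difference. -/
def ZAgreeing {X : Type*} [DecidableEq X]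
    (Z : Finset (Finset X)) (F : Finset (Finset X)) : Prop :=
  ∀ A ∈ F, ∀ B ∈ F, ∃ Z₀ ∈ Z, Z₀ ∩ ((A \ B) ∪ (B \ A)) = ∅

theorem ZIntersecting.zAgreeing {X : Type*} [DecidableEq X] {Z F : Finset (Finset X)}
    (h : ZIntersecting Z F) : ZAgreeing Z F := by
  intro A hA B hB
  obtain ⟨S, hS, hSAB⟩ := h A hA B hB
  refine ⟨S, hS, ?_⟩
  ext x
  have := @hSAB x
  grind

theorem zAgreeing_iff {X : Type*} [DecidableEq X] {Z F : Finset (Finset X)} :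
    ZAgreeing Z F ↔ ∀ A ∈ F, ∀ B ∈ F, ∃ S ∈ Z, ∀ x ∈ S, x ∈ A ↔ x ∈ B := by
  simp only [ZAgreeing, Finset.eq_empty_iff_forall_notMem, Finset.mem_inter, Finset.mem_union,
    Finset.mem_sdiff]
  grind

/-- Down-compression preserves the agreeing property. -/
theorem ZAgreeing.compression {X : Type*} [DecidableEq X] {Z F : Finset (Finset X)}
    (h : ZAgreeing Z F) (a : X) : ZAgreeing Z (Down.compression a F) := by
  rw [zAgreeing_iff] at h ⊢
  /- A member containing `a` belongs to `F` both with and without `a`, so when it meets a member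
  avoiding `a` we may compare representatives in `F` that disagree at `a`. -/
  have key : ∀ A ∈ F, A.erase a ∈ F → a ∈ A → ∀ B, a ∉ B → (B ∈ F ∨ insert a B ∈ F) →
      ∃ S ∈ Z, ∀ x ∈ S, x ∈ A ↔ x ∈ B := by
    rintro A hA hA' haA B haB (hB | hB)
    · exact h A hA B hB
    · obtain ⟨S, hS, hSAB⟩ := h _ hA' _ hB
      refine ⟨S, hS, fun x hx ↦ ?_⟩
      have := hSAB x hx
      grind
  have mem : ∀ A ∈ Down.compression a F,
      (a ∈ A ∧ A ∈ F ∧ A.erase a ∈ F) ∨ (a ∉ A ∧ (A ∈ F ∨ insert a A ∈ F)) := by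
    intro A hA
    rw [Down.mem_compression] at hA
    by_cases haA : a ∈ A <;> grind
  intro A hA B hB
  rcases mem A hA with ⟨haA, hA₁, hA₂⟩ | ⟨haA, hA₁⟩ <;>
    rcases mem B hB with ⟨haB, hB₁, hB₂⟩ | ⟨haB, hB₁⟩
  · exact h A hA₁ B hB₁
  · exact key A hA₁ hA₂ haA B haB hB₁
  · obtain ⟨S, hS, hSAB⟩ := key B hB₁ hB₂ haB A haA hA₁
    exact ⟨S, hS, fun x hx ↦ (hSAB x hx).symm⟩
  · have aux : ∃ A' ∈ F, ∃ B' ∈ F, (∀ x ≠ a, x ∈ A' ↔ x ∈ A) ∧ (∀ x ≠ a, x ∈ B' ↔ x ∈ B) := by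
      rcases hA₁ with hA₁ | hA₁ <;> rcases hB₁ with hB₁ | hB₁ <;>
        exact ⟨_, hA₁, _, hB₁, by grind, by grind⟩
    obtain ⟨A', hA', B', hB', hAA', hBB'⟩ := aux
    obtain ⟨S, hS, hSAB⟩ := h A' hA' B' hB'
    refine ⟨S, hS, fun x hx ↦ ?_⟩
    by_cases hxa : x = a
    · simp [hxa, haA, haB]
    · rw [← hAA' x hxa, ← hBB' x hxa, hSAB x hx]

theorem Down.erase_mem_compression_of_forall {X : Type*} [DecidableEq X]
    {F : Finset (Finset X)} {a i : X} (h : ∀ A ∈ F, A.erase i ∈ F) :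
    ∀ A ∈ Down.compression a F, A.erase i ∈ Down.compression a F := by
  intro A hA
  by_cases hai : i = a
  · subst hai
    exact Down.erase_mem_compression_of_mem_compression hA
  · have h₁ := h A
    have h₂ := h (A.erase a)
    have h₃ := h (insert a A)
    rw [Finset.erase_right_comm] at h₂
    rw [Finset.erase_insert_of_ne (Ne.symm hai)] at h₃
    rw [Down.mem_compression] at hA ⊢
    by_cases haA : a ∈ A
    · grind
    · have haA' : a ∉ A.erase i := fun h ↦ haA (Finset.mem_of_mem_erase h)
      rw [Finset.erase_eq_of_notMem haA']
      tauto

theorem ZAgreeing.exists_isLowerSet {X : Type*} [Fintype X] [DecidableEq X]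
    {Z F : Finset (Finset X)} (h : ZAgreeing Z F) :
    ∃ G, ZAgreeing Z G ∧ G.card = F.card ∧ IsLowerSet (G : Set (Finset X)) := by
  have closed : ∀ T : Finset X, ∃ G, ZAgreeing Z G ∧ G.card = F.card ∧
      ∀ i ∈ T, ∀ A ∈ G, A.erase i ∈ G := by
    intro T
    induction T using Finset.induction_on with
    | empty => exact ⟨F, h, rfl, by simp⟩
    | insert a T _ ih =>
      obtain ⟨G, hG, hcard, herase⟩ := ih
      refine ⟨Down.compression a G, hG.compression a, by rw [Down.card_compression, hcard], ?_⟩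
      intro i hi
      rcases Finset.mem_insert.1 hi with rfl | hi
      · exact fun A hA ↦ Down.erase_mem_compression_of_mem_compression hA
      · exact Down.erase_mem_compression_of_forall (herase i hi)
  obtain ⟨G, hG, hcard, herase⟩ := closed Finset.univ
  refine ⟨G, hG, hcard, fun A B hBA hA ↦ ?_⟩
  have sdiff_mem : ∀ T : Finset X, A \ T ∈ G := by
    intro T
    induction T using Finset.induction_on with
    | empty => simpa using hA
    | insert a T _ ih =>
      rw [Finset.sdiff_insert]
      exact herase a (Finset.mem_univ a) _ ih
  simpa [Finset.sdiff_sdiff_eq_self hBA] using sdiff_mem (A \ B)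

theorem ZAgreeing.zIntersecting_compls {X : Type*} [Fintype X] [DecidableEq X]
    {Z F : Finset (Finset X)} (h : ZAgreeing Z F) (hF : IsLowerSet (F : Set (Finset X))) :
    ZIntersecting Z F.compls := by
  intro A hA B hB
  rw [Finset.mem_compls] at hA hB
  obtain ⟨S, hS, hSAB⟩ := zAgreeing_iff.1 h Aᶜ hA (Bᶜ \ Aᶜ) (hF Finset.sdiff_subset hB)
  refine ⟨S, hS, fun x hx ↦ ?_⟩
  have := hSAB x hx
  simp only [Finset.mem_compl, Finset.mem_sdiff, Finset.mem_inter] at this ⊢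
  tauto

theorem max_agreeing_eq_max_intersecting
    (X : Type*) [Fintype X] [DecidableEq X] (Z : Finset (Finset X)) :
    sSup {k : ℕ | ∃ F : Finset (Finset X), ZAgreeing Z F ∧ F.card = k} =
      sSup {k : ℕ | ∃ F : Finset (Finset X), ZIntersecting Z F ∧ F.card = k} := by
  congr 1
  ext k
  constructor
  · rintro ⟨F, hF, rfl⟩
    obtain ⟨G, hG, hcard, hlower⟩ := hF.exists_isLowerSet
    exact ⟨G.compls, hG.zIntersecting_compls hlower, by rw [Finset.card_compls, hcard]⟩
  · rintro ⟨F, hF, rfl⟩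
    exact ⟨F, hF.zAgreeing, rfl⟩
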